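/- arXiv:1511.04073 — 4 statements merged into one kernel-verified Lean document; each statement's English description precedes it below -/
import Mathlib

section
/- With M = ⊕_{i=1}^s m^{σ_i}(σ_i) ⊂ F = ⊕_{i=1}^s R(σ_i), the Rees algebra of M equals the subring R[{x_0^{σ_i−j} x_1^j w_i : 1 ≤ i ≤ s, 0 ≤ j ≤ σ_i}] of R(F) = R[w_1,…,w_s], and R(M) is isomorphic as an R-algebra to Scr(σ_1,…,σ_s) = V/I_2(Γ), the determinantal ring of 2×2 minors of the scroll matrix Γ. -/
/-!
STATEMENT 3 (Proposition `rns`).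
With `M = ⊕ 𝔪^{σ_i}(σ_i) ⊂ F = ⊕ R(σ_i)` and `R(M) = R(F)_{≥0,*}` (the nonnegative
x-degree part of `R(F) = R[w₁,…,w_s]`, which is the Rees algebra of `M`): the Rees
algebra `R(M)` equals the `R`-subalgebra of `R(F)` generated by
`{x₀^{σ_i−j} x₁^j w_i : 1 ≤ i ≤ s, 0 ≤ j ≤ σ_i}`, and `R(M)` is isomorphic as an
`R`-algebra to the scroll ring `Scr(σ₁,…,σ_s) = V/I₂(Γ)`.

Conventions: `R(F)` is `MvPolynomial (Fin s) R`; an element lies in `R(F)_{≥0,*}` iff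
for every `w`-exponent `α` every homogeneous component of `coeff α f` of degree `< α·σ`
vanishes.  `V = R[v_{i,j}]` and `Γ` is the scroll matrix with first column `(x₀,x₁)ᵀ`
and columns `(v_{i,j}, v_{i,j+1})ᵀ` for `0 ≤ j ≤ σ_i − 1`.
-/

open MvPolynomial

noncomputable section

variable (k : Type) [Field k] (s : ℕ) (σ : Fin s → ℕ)

/-- `R(F) = R[w₁,…,w_s]`. -/
abbrev SF3 := MvPolynomial (Fin s) (MvPolynomial (Fin 2) k)

/-- membership in `R(F)_{≥0,*}`, the Rees algebra of `M = F_{≥0}`. -/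
def nonnegPart (f : SF3 k s) : Prop :=
  ∀ (α : Fin s →₀ ℕ) (e : ℕ), e < ∑ i, α i * σ i → homogeneousComponent e (coeff α f) = 0

/-- the generators `x₀^{σ_i−j} x₁^j w_i`, `0 ≤ j ≤ σ_i`. -/
def scrollGens : Set (SF3 k s) :=
  {p | ∃ (i : Fin s) (j : ℕ), j ≤ σ i ∧
    p = C ((X 0 : MvPolynomial (Fin 2) k) ^ (σ i - j) * (X 1) ^ j) * X i}

/-- the polynomial ring `V = R[{v_{i,j} : 1 ≤ i ≤ s, 0 ≤ j ≤ σ_i}]`. -/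
abbrev Vring := MvPolynomial ((i : Fin s) × Fin (σ i + 1)) (MvPolynomial (Fin 2) k)

/-- the scroll matrix `Γ`. -/
def scrollΓ : Matrix (Fin 2) (Option ((i : Fin s) × Fin (σ i))) (Vring k s σ) :=
  Matrix.of fun a c =>
    match c with
    | none => C (X a)
    | some ⟨i, j⟩ => if a = 0 then X ⟨i, j.castSucc⟩ else X ⟨i, j.succ⟩

/-- the ideal of `2 × 2` minors of `Γ`. -/
def minors2 : Ideal (Vring k s σ) :=
  Ideal.span {p | ∃ c₁ c₂, p = scrollΓ k s σ 0 c₁ * scrollΓ k s σ 1 c₂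
    - scrollΓ k s σ 0 c₂ * scrollΓ k s σ 1 c₁}

/-- The product of scroll variables with letters `L` in which a total weight `n` is distributed
greedily. -/
def greedyProd {A Q : Type*} [CommSemiring Q] (len : A → ℕ) (x : A → ℕ → Q) : List A → ℕ → Q
  | [], _ => 1
  | a :: L, n => x a (min n (len a)) * greedyProd len x L (n - min n (len a))

section Straightening

variable {A Q : Type*} [CommSemiring Q] {len : A → ℕ} {x : A → ℕ → Q}

theorem mul_greedyProd_succ
    (hx : ∀ a b p q, p < len a → q < len b → x a (p + 1) * x b q = x a p * x b (q + 1))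
    (a : A) (p : ℕ) (hp : p < len a) (L : List A) (n : ℕ) (hn : n + 1 ≤ (L.map len).sum) :
    x a p * greedyProd len x L (n + 1) = x a (p + 1) * greedyProd len x L n := by
  induction L generalizing n with
  | nil => simp at hn
  | cons b L ih =>
    simp only [List.map_cons, List.sum_cons] at hn
    simp only [greedyProd]
    by_cases h : n + 1 ≤ len b
    · rw [min_eq_left h, min_eq_left (by omega : n ≤ len b), ← mul_assoc, ← mul_assoc,
        hx a b p n hp h]
      simp
    · have e : n + 1 - len b = (n - len b) + 1 := by omega
      rw [min_eq_right (by omega : len b ≤ n + 1), min_eq_right (by omega : len b ≤ n), e,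
        mul_left_comm, ih _ (by omega), mul_left_comm]

theorem mul_greedyProd
    (hx : ∀ a b p q, p < len a → q < len b → x a (p + 1) * x b q = x a p * x b (q + 1))
    (a : A) (p : ℕ) (hp : p ≤ len a) (L : List A) (n : ℕ) (hn : n ≤ (L.map len).sum) :
    x a p * greedyProd len x L n = greedyProd len x (a :: L) (p + n) := by
  induction n generalizing p with
  | zero => simp [greedyProd, hp]
  | succ n ih =>
    rcases hp.lt_or_eq with h | rfl
    · rw [mul_greedyProd_succ hx a p h L n hn, ih (p + 1) h (by omega)]
      congr 1
      omega
    · simp [greedyProd]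

theorem greedyProd_perm
    (hx : ∀ a b p q, p < len a → q < len b → x a (p + 1) * x b q = x a p * x b (q + 1))
    {L L' : List A} (h : L.Perm L') (n : ℕ) (hn : n ≤ (L.map len).sum) :
    greedyProd len x L n = greedyProd len x L' n := by
  induction h generalizing n with
  | nil => rfl
  | cons a _ ih =>
    simp only [List.map_cons, List.sum_cons] at hn
    simp only [greedyProd]
    rw [ih _ (by omega)]
  | swap a b L =>
    simp only [List.map_cons, List.sum_cons] at hn
    obtain ⟨p, q, m, hp, hq, hm, rfl⟩ : ∃ p q m, p ≤ len a ∧ q ≤ len b ∧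
        m ≤ (L.map len).sum ∧ n = p + (q + m) :=
      ⟨min n (len a), min (n - min n (len a)) (len b), n - min n (len a) -
        min (n - min n (len a)) (len b), by omega, by omega, by omega, by omega⟩
    rw [← mul_greedyProd hx a p hp (b :: L) (q + m)
        (by simp only [List.map_cons, List.sum_cons]; omega), ← mul_greedyProd hx b q hq L m hm,
      mul_left_comm, mul_greedyProd hx a p hp L m hm,
      mul_greedyProd hx b q hq (a :: L) (p + m)
        (by simp only [List.map_cons, List.sum_cons]; omega), add_left_comm]
  | trans h₁ _ ih₁ ih₂ =>
    rw [ih₁ n hn, ih₂ n ((h₁.map len).sum_eq ▸ hn)]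

theorem prod_eq_greedyProd
    (hx : ∀ a b p q, p < len a → q < len b → x a (p + 1) * x b q = x a p * x b (q + 1))
    (l : List (A × ℕ)) (hl : ∀ y ∈ l, y.2 ≤ len y.1) :
    (l.map fun y => x y.1 y.2).prod
      = greedyProd len x (l.map Prod.fst) (l.map Prod.snd).sum := by
  induction l with
  | nil => simp [greedyProd]
  | cons y l ih =>
    have hl' : ∀ z ∈ l, z.2 ≤ len z.1 := fun z hz => hl z (by simp [hz])
    simp only [List.map_cons, List.prod_cons, List.sum_cons]
    rw [ih hl', mul_greedyProd hx _ _ (hl y (by simp))]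
    rw [List.map_map]
    exact List.sum_le_sum hl'

end Straightening

theorem nonnegPart_iff (f : SF3 k s) :
    nonnegPart k s σ f ↔
      ∀ α β, coeff β (coeff α f) ≠ 0 → ∑ i, α i * σ i ≤ β.degree := by
  constructor
  · intro h α β hc
    by_contra! hlt
    have := congrArg (coeff β) (h α _ hlt)
    rw [coeff_homogeneousComponent, if_pos rfl, coeff_zero] at this
    exact hc this
  · intro h α e he
    ext β
    rw [coeff_homogeneousComponent, coeff_zero]
    split_ifs with hd
    · by_contra hc
      have := h α β hc
      omega
    · rfl

theorem nonnegPart_add {f g : SF3 k s} (hf : nonnegPart k s σ f) (hg : nonnegPart k s σ g) :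
    nonnegPart k s σ (f + g) := fun α e he => by
  rw [coeff_add, map_add, hf α e he, hg α e he, add_zero]

theorem nonnegPart_mul {f g : SF3 k s} (hf : nonnegPart k s σ f) (hg : nonnegPart k s σ g) :
    nonnegPart k s σ (f * g) := by
  classical
  rw [nonnegPart_iff] at *
  intro α β hc
  rw [coeff_mul, coeff_sum] at hc
  obtain ⟨u, hu, hc⟩ := Finset.exists_ne_zero_of_sum_ne_zero hc
  rw [coeff_mul] at hc
  obtain ⟨v, hv, hc⟩ := Finset.exists_ne_zero_of_sum_ne_zero hc
  rw [Finset.HasAntidiagonal.mem_antidiagonal] at hu hv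
  have h₁ := hf _ _ (left_ne_zero_of_mul hc)
  have h₂ := hg _ _ (right_ne_zero_of_mul hc)
  rw [← hu, ← hv, map_add]
  simp only [Finsupp.add_apply, add_mul, Finset.sum_add_distrib]
  omega

theorem nonnegPart_C (r : MvPolynomial (Fin 2) k) : nonnegPart k s σ (C r) := by
  classical
  intro α e he
  rw [coeff_C]
  split_ifs with h
  · subst h
    simp at he
  · simp

theorem X_pow_mul_X_pow_eq_monomial (a b : ℕ) :
    (X 0 : MvPolynomial (Fin 2) k) ^ a * X 1 ^ b
      = monomial (Finsupp.single 0 a + Finsupp.single 1 b) 1 := by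
  rw [X_pow_eq_monomial, X_pow_eq_monomial, monomial_mul, mul_one]

theorem nonnegPart_of_mem_scrollGens {f : SF3 k s} (hf : f ∈ scrollGens k s σ) :
    nonnegPart k s σ f := by
  classical
  obtain ⟨i, j, hj, rfl⟩ := hf
  rw [nonnegPart_iff]
  intro α β hc
  rw [coeff_C_mul, coeff_X, X_pow_mul_X_pow_eq_monomial] at hc
  split_ifs at hc with h
  · subst h
    rw [mul_one, coeff_monomial] at hc
    split_ifs at hc with h
    · subst h
      have hs : ∑ l, (Finsupp.single i 1 : Fin s →₀ ℕ) l * σ l = σ i := by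
        simp [Finsupp.single_apply]
      rw [hs, map_add, Finsupp.degree_single, Finsupp.degree_single]
      omega
    · exact absurd rfl hc
  · simp at hc

theorem monomial_mem_adjoin (α : Fin s →₀ ℕ) (β : Fin 2 →₀ ℕ) (c : k)
    (h : ∑ i, α i * σ i ≤ β.degree) :
    (monomial α (monomial β c) : SF3 k s) ∈
      Algebra.adjoin (MvPolynomial (Fin 2) k) (scrollGens k s σ) := by
  induction hn : α.degree generalizing α β with
  | zero =>
    obtain rfl := (Finsupp.degree_eq_zero_iff α).1 hn
    exact Subalgebra.algebraMap_mem _ (monomial β c)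
  | succ n ih =>
    obtain ⟨i, hi⟩ : ∃ i, α i ≠ 0 := by
      by_contra! h0
      have : α = 0 := Finsupp.ext h0
      simp [this] at hn
    obtain ⟨α', rfl⟩ : ∃ α', α = α' + Finsupp.single i 1 :=
      ⟨α - Finsupp.single i 1,
        (tsub_add_cancel_of_le (by simpa using Nat.one_le_iff_ne_zero.2 hi)).symm⟩
    have hs : ∑ l, (α' + Finsupp.single i 1 : Fin s →₀ ℕ) l * σ l = ∑ l, α' l * σ l + σ i := by
      simp [add_mul, Finset.sum_add_distrib, Finsupp.single_apply]
    rw [hs] at h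
    have hβ : β.degree = β 0 + β 1 := by
      rw [Finsupp.degree_eq_sum, Fin.sum_univ_two]
    have hj : ∃ j, j ≤ σ i ∧ j ≤ β 1 ∧ σ i - j ≤ β 0 :=
      ⟨min (β 1) (σ i), by omega, by omega, by omega⟩
    obtain ⟨j, hj, hj1, hj0⟩ := hj
    obtain ⟨β', rfl⟩ : ∃ β', β = β' + (Finsupp.single 0 (σ i - j) + Finsupp.single 1 j) :=
      ⟨β - (Finsupp.single 0 (σ i - j) + Finsupp.single 1 j), (tsub_add_cancel_of_le (by
        intro l
        fin_cases l <;> simp [hj0, hj1])).symm⟩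
    have e : (monomial (α' + Finsupp.single i 1)
        (monomial (β' + (Finsupp.single 0 (σ i - j) + Finsupp.single 1 j)) c) : SF3 k s)
        = monomial α' (monomial β' c) *
          (C ((X 0 : MvPolynomial (Fin 2) k) ^ (σ i - j) * (X 1) ^ j) * X i) := by
      rw [X_pow_mul_X_pow_eq_monomial, X, C_mul_monomial, monomial_mul, mul_one, monomial_mul,
        mul_one]
    rw [e]
    refine mul_mem (ih α' β' ?_ ?_) (Algebra.subset_adjoin ⟨i, j, hj, rfl⟩)
    · simp only [map_add, Finsupp.degree_single] at h
      omega
    · simpa using hn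

theorem adjoin_scrollGens_eq :
    (Algebra.adjoin (MvPolynomial (Fin 2) k) (scrollGens k s σ) : Set (SF3 k s))
      = {f | nonnegPart k s σ f} := by
  ext f
  simp only [SetLike.mem_coe, Set.mem_ofPred_eq]
  constructor
  · intro hf
    induction hf using Algebra.adjoin_induction with
    | mem f hf => exact nonnegPart_of_mem_scrollGens k s σ hf
    | algebraMap r => exact nonnegPart_C k s σ r
    | add f g _ _ hf hg => exact nonnegPart_add k s σ hf hg
    | mul f g _ _ hf hg => exact nonnegPart_mul k s σ hf hg
  · intro hf
    rw [nonnegPart_iff] at hf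
    rw [f.as_sum]
    refine sum_mem fun α _ => ?_
    rw [(coeff α f).as_sum, map_sum]
    exact sum_mem fun β hβ => monomial_mem_adjoin k s σ α β _ (hf α β (mem_support_iff.1 hβ))

/-- The `R`-algebra map `v_{i,j} ↦ x₀^{σ_i−j} x₁^j w_i`. -/
def scrollHom : Vring k s σ →ₐ[MvPolynomial (Fin 2) k] SF3 k s :=
  aeval fun v => C ((X 0 : MvPolynomial (Fin 2) k) ^ (σ v.1 - v.2) * (X 1) ^ (v.2 : ℕ)) * X v.1

theorem range_scrollHom :
    (scrollHom k s σ).range = Algebra.adjoin (MvPolynomial (Fin 2) k) (scrollGens k s σ) := by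
  rw [scrollHom, ← Algebra.adjoin_range_eq_range_aeval]
  congr 1
  ext p
  constructor
  · rintro ⟨⟨i, j⟩, rfl⟩
    exact ⟨i, j, by omega, rfl⟩
  · rintro ⟨i, j, hj, rfl⟩
    exact ⟨⟨i, ⟨j, by omega⟩⟩, rfl⟩

/-- The largest second index in the block of the scroll matrix with the given label, `none`
labelling the column `(x₀, x₁)ᵀ`. -/
def blockLen : Option (Fin s) → ℕ
  | none => 1
  | some i => σ i

/-- The entries of the blocks of the scroll matrix. -/
def blockVar : Option (Fin s) → ℕ → Vring k s σ
  | none, p => C (X (Fin.ofNat 2 p))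
  | some i, p => X ⟨i, Fin.ofNat (σ i + 1) p⟩

/-- The image of a block label in `R(F)`. -/
def blockImage : Option (Fin s) → SF3 k s
  | none => 1
  | some i => X i

theorem scrollHom_blockVar (a : Option (Fin s)) (p : ℕ) (hp : p ≤ blockLen s σ a) :
    scrollHom k s σ (blockVar k s σ a p)
      = C ((X 0 : MvPolynomial (Fin 2) k) ^ (blockLen s σ a - p) * (X 1) ^ p) *
        blockImage k s a := by
  cases a with
  | none =>
    simp only [blockLen] at hp
    rw [blockVar, ← algebraMap_eq, AlgHom.commutes, algebraMap_eq]
    interval_cases p <;> simp [blockLen, blockImage]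
  | some i =>
    simp only [blockLen] at hp
    simp [blockVar, scrollHom, blockLen, blockImage, Nat.mod_eq_of_lt (Nat.lt_succ_of_le hp)]

theorem exists_block_of_column (c : Option ((i : Fin s) × Fin (σ i))) :
    ∃ a p, p < blockLen s σ a ∧ scrollΓ k s σ 0 c = blockVar k s σ a p ∧
      scrollΓ k s σ 1 c = blockVar k s σ a (p + 1) := by
  rcases c with _ | ⟨i, j⟩
  · exact ⟨none, 0, by simp [blockLen], by simp [scrollΓ, blockVar], by simp [scrollΓ, blockVar]⟩
  · refine ⟨some i, j, j.2, ?_, ?_⟩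
    · simp only [scrollΓ, blockVar, Matrix.of_apply, if_true]
      congr 2
      ext
      simp
    · simp only [scrollΓ, blockVar, Matrix.of_apply, one_ne_zero, if_false]
      congr 2
      ext
      simp [Nat.mod_eq_of_lt (by omega : (j : ℕ) + 1 < σ i + 1)]

theorem exists_column_of_block (a : Option (Fin s)) (p : ℕ) (hp : p < blockLen s σ a) :
    ∃ c, scrollΓ k s σ 0 c = blockVar k s σ a p ∧
      scrollΓ k s σ 1 c = blockVar k s σ a (p + 1) := by
  cases a with
  | none =>
    obtain rfl : p = 0 := by simpa [blockLen] using hp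
    exact ⟨none, by simp [scrollΓ, blockVar], by simp [scrollΓ, blockVar]⟩
  | some i =>
    simp only [blockLen] at hp
    refine ⟨some ⟨i, p, hp⟩, ?_, ?_⟩
    · simp only [scrollΓ, blockVar, Matrix.of_apply, if_true]
      congr 2
      ext
      simp [Nat.mod_eq_of_lt (by omega : p < σ i + 1)]
    · simp only [scrollΓ, blockVar, Matrix.of_apply, one_ne_zero, if_false]
      congr 2
      ext
      simp [Nat.mod_eq_of_lt (by omega : p + 1 < σ i + 1)]

theorem minors2_le_ker : minors2 k s σ ≤ RingHom.ker (scrollHom k s σ) := by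
  rw [minors2, Ideal.span_le]
  rintro _ ⟨c₁, c₂, rfl⟩
  obtain ⟨a, p, hp, h₁, h₂⟩ := exists_block_of_column k s σ c₁
  obtain ⟨b, q, hq, h₃, h₄⟩ := exists_block_of_column k s σ c₂
  rw [SetLike.mem_coe, RingHom.mem_ker, h₁, h₂, h₃, h₄, map_sub, map_mul, map_mul,
    scrollHom_blockVar _ _ _ _ _ hp.le, scrollHom_blockVar _ _ _ _ _ hp,
    scrollHom_blockVar _ _ _ _ _ hq.le, scrollHom_blockVar _ _ _ _ _ hq]
  obtain ⟨u, hu⟩ := Nat.exists_eq_add_of_lt hp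
  obtain ⟨v, hv⟩ := Nat.exists_eq_add_of_lt hq
  rw [show blockLen s σ a - p = u + 1 by omega, show blockLen s σ a - (p + 1) = u by omega,
    show blockLen s σ b - q = v + 1 by omega, show blockLen s σ b - (q + 1) = v by omega]
  simp only [map_mul, map_pow, pow_succ]
  ring

theorem mk_blockVar_swap (a b : Option (Fin s)) (p q : ℕ) (hp : p < blockLen s σ a)
    (hq : q < blockLen s σ b) :
    Ideal.Quotient.mk (minors2 k s σ) (blockVar k s σ a (p + 1)) *
        Ideal.Quotient.mk (minors2 k s σ) (blockVar k s σ b q)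
      = Ideal.Quotient.mk (minors2 k s σ) (blockVar k s σ a p) *
        Ideal.Quotient.mk (minors2 k s σ) (blockVar k s σ b (q + 1)) := by
  obtain ⟨c₁, h₁, h₂⟩ := exists_column_of_block k s σ a p hp
  obtain ⟨c₂, h₃, h₄⟩ := exists_column_of_block k s σ b q hq
  rw [← map_mul, ← map_mul, eq_comm, Ideal.Quotient.eq]
  refine Ideal.subset_span ⟨c₁, c₂, ?_⟩
  rw [h₁, h₂, h₃, h₄]
  ring

theorem exists_list_of_monomial (β : Fin 2 →₀ ℕ) (γ : ((i : Fin s) × Fin (σ i + 1)) →₀ ℕ) :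
    ∃ l : List (Option (Fin s) × ℕ), (∀ y ∈ l, y.2 ≤ blockLen s σ y.1) ∧
      (monomial γ (monomial β 1) : Vring k s σ)
        = (l.map fun y => blockVar k s σ y.1 y.2).prod := by
  let S : Submonoid (Vring k s σ) :=
    { carrier := {f | ∃ l : List (Option (Fin s) × ℕ), (∀ y ∈ l, y.2 ≤ blockLen s σ y.1) ∧
        f = (l.map fun y => blockVar k s σ y.1 y.2).prod}
      one_mem' := ⟨[], by simp, by simp⟩
      mul_mem' := by
        rintro _ _ ⟨l, hl, rfl⟩ ⟨l', hl', rfl⟩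
        refine ⟨l ++ l', ?_, by simp⟩
        intro y hy
        rcases List.mem_append.1 hy with h | h
        exacts [hl y h, hl' y h] }
  have hC : ∀ j : Fin 2, (C (X j) : Vring k s σ) ∈ S := fun j =>
    ⟨[(none, j)], by simp [blockLen]; omega, by simp [blockVar]⟩
  have hX : ∀ v, (X v : Vring k s σ) ∈ S := fun ⟨i, j⟩ =>
    ⟨[(some i, j)], by simp [blockLen]; omega, by simp [blockVar]⟩
  change _ ∈ S
  rw [← mul_one (monomial β (1 : k)), ← C_mul_monomial]
  refine mul_mem ?_ ?_
  · rw [monomial_eq, map_one, one_mul, Finsupp.prod, map_prod]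
    exact prod_mem fun j _ => by simpa using pow_mem (hC j) _
  · rw [monomial_eq, map_one, one_mul, Finsupp.prod]
    exact prod_mem fun v _ => pow_mem (hX v) _

/-- The block labels in any product of block variables with image `x^β w^α`. -/
def monomialBlocks (β : Fin 2 →₀ ℕ) (α : Fin s →₀ ℕ) : Multiset (Option (Fin s)) :=
  Multiset.replicate (β.degree - ∑ i, α i * σ i) none + (Finsupp.toMultiset α).map some

theorem exists_scrollHom_prod_eq (l : List (Option (Fin s) × ℕ))
    (hl : ∀ y ∈ l, y.2 ≤ blockLen s σ y.1) :
    ∃ (β : Fin 2 →₀ ℕ) (α : Fin s →₀ ℕ),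
      scrollHom k s σ (l.map fun y => blockVar k s σ y.1 y.2).prod = monomial α (monomial β 1) ∧
      β 1 = (l.map Prod.snd).sum ∧ ∑ i, α i * σ i ≤ β.degree ∧
      monomialBlocks s σ β α = (l.map Prod.fst : List (Option (Fin s))) := by
  induction l with
  | nil => exact ⟨0, 0, by simp [monomial_zero'], by simp, by simp, by simp [monomialBlocks]⟩
  | cons y l ih =>
    obtain ⟨β, α, h₁, h₂, h₃, h₄⟩ := ih fun z hz => hl z (by simp [hz])
    obtain ⟨a, p⟩ := y
    have hp : p ≤ blockLen s σ a := hl (a, p) (by simp)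
    have hd : (Finsupp.single (0 : Fin 2) (blockLen s σ a - p) + Finsupp.single 1 p).degree
        = blockLen s σ a := by
      simp only [map_add, Finsupp.degree_single]
      omega
    cases a with
    | none =>
      refine ⟨Finsupp.single 0 (1 - p) + Finsupp.single 1 p + β, α, ?_, ?_, ?_, ?_⟩
      · rw [List.map_cons, List.prod_cons, map_mul, h₁, scrollHom_blockVar _ _ _ _ _ hp,
          X_pow_mul_X_pow_eq_monomial]
        simp [blockImage, blockLen, C_mul_monomial, monomial_mul]
      · simp [h₂]
      · rw [map_add]
        exact h₃.trans (Nat.le_add_left _ _)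
      · rw [List.map_cons, ← Multiset.cons_coe, ← h₄, monomialBlocks, monomialBlocks, map_add]
        change (Finsupp.single (0 : Fin 2) (1 - p) + Finsupp.single 1 p).degree = 1 at hd
        rw [hd, show 1 + β.degree - ∑ i, α i * σ i = (β.degree - ∑ i, α i * σ i) + 1 by omega,
          Multiset.replicate_succ, Multiset.cons_add]
    | some i =>
      have hs : ∑ l, (Finsupp.single i 1 + α : Fin s →₀ ℕ) l * σ l = σ i + ∑ l, α l * σ l := by
        simp [add_mul, Finset.sum_add_distrib, Finsupp.single_apply]
      change (Finsupp.single (0 : Fin 2) (σ i - p) + Finsupp.single 1 p).degree = σ i at hd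
      refine ⟨Finsupp.single 0 (σ i - p) + Finsupp.single 1 p + β, Finsupp.single i 1 + α,
        ?_, ?_, ?_, ?_⟩
      · rw [List.map_cons, List.prod_cons, map_mul, h₁, scrollHom_blockVar _ _ _ _ _ hp,
          X_pow_mul_X_pow_eq_monomial]
        simp [blockImage, blockLen, C_mul_monomial, monomial_mul, X]
      · simp [h₂]
      · rw [map_add, hs, hd]
        omega
      · rw [List.map_cons, ← Multiset.cons_coe, ← h₄, monomialBlocks, monomialBlocks, map_add,
          hs, hd, Nat.add_sub_add_left, map_add, Finsupp.toMultiset_single]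
        simp

theorem ker_scrollHom_le : RingHom.ker (scrollHom k s σ) ≤ minors2 k s σ := by
  let bF := (basisMonomials (Fin 2) k).smulTower
    (basisMonomials (Fin s) (MvPolynomial (Fin 2) k))
  let bV := (basisMonomials (Fin 2) k).smulTower
    (basisMonomials ((i : Fin s) × Fin (σ i + 1)) (MvPolynomial (Fin 2) k))
  have hbF : ∀ β α, bF (β, α) = monomial α (monomial β 1) := fun β α => by
    simp [bF, Module.Basis.smulTower_apply, smul_monomial]
  have hbV : ∀ β γ, bV (β, γ) = monomial γ (monomial β 1) := fun β γ => by
    simp [bV, Module.Basis.smulTower_apply, smul_monomial]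
  let x : Option (Fin s) → ℕ → Vring k s σ ⧸ minors2 k s σ :=
    fun a p => Ideal.Quotient.mk (minors2 k s σ) (blockVar k s σ a p)
  have hx : ∀ a b p q, p < blockLen s σ a → q < blockLen s σ b →
      x a (p + 1) * x b q = x a p * x b (q + 1) := mk_blockVar_swap k s σ
  let τ : SF3 k s →ₗ[k] (Vring k s σ ⧸ minors2 k s σ) := bF.constr k fun m =>
    greedyProd (blockLen s σ) x (monomialBlocks s σ m.1 m.2).toList (m.1 1)
  have key : τ ∘ₗ ((scrollHom k s σ).restrictScalars k).toLinearMap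
      = (Ideal.Quotient.mkₐ k (minors2 k s σ)).toLinearMap := by
    refine bV.ext fun ⟨β, γ⟩ => ?_
    rw [hbV]
    obtain ⟨l, hl, e⟩ := exists_list_of_monomial k s σ β γ
    obtain ⟨β', α, h₁, h₂, h₃, h₄⟩ := exists_scrollHom_prod_eq k s σ l hl
    rw [e]
    change τ (scrollHom k s σ _) = Ideal.Quotient.mk (minors2 k s σ) _
    rw [h₁, ← hbF, Module.Basis.constr_basis, map_list_prod, List.map_map]
    have hp : (monomialBlocks s σ β' α).toList.Perm (l.map Prod.fst) := by
      rw [← Multiset.coe_eq_coe, Multiset.coe_toList, h₄]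
    refine Eq.trans ?_ (prod_eq_greedyProd (x := x) hx l hl).symm
    rw [← h₂]
    refine greedyProd_perm hx hp _ ?_
    rw [(hp.map _).sum_eq, h₂, List.map_map]
    exact List.sum_le_sum hl
  intro f hf
  rw [RingHom.mem_ker] at hf
  rw [← Ideal.Quotient.eq_zero_iff_mem]
  have := LinearMap.congr_fun key f
  change τ (scrollHom k s σ f) = Ideal.Quotient.mk (minors2 k s σ) f at this
  rw [← this, hf, map_zero]

theorem stmt3 (hσ : Antitone σ) :
    -- `R(M) = R[{x₀^{σ_i−j} x₁^j w_i}] ⊂ R(F)`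
    ((Algebra.adjoin (MvPolynomial (Fin 2) k) (scrollGens k s σ) : Set (SF3 k s))
      = {f | nonnegPart k s σ f})
    -- `R(M) ≅ Scr(σ₁,…,σ_s) = V/I₂(Γ)` as `R`-algebras
    ∧ Nonempty ((Vring k s σ ⧸ minors2 k s σ) ≃ₐ[MvPolynomial (Fin 2) k]
        (Algebra.adjoin (MvPolynomial (Fin 2) k) (scrollGens k s σ))) := by
  refine ⟨adjoin_scrollGens_eq k s σ, ⟨?_⟩⟩
  have hker : minors2 k s σ = RingHom.ker (scrollHom k s σ).rangeRestrict := by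
    rw [AlgHom.ker_rangeRestrict]
    exact le_antisymm (minors2_le_ker k s σ) (ker_scrollHom_le k s σ)
  exact (Ideal.quotientEquivAlgOfEq _ hker).trans <|
    (Ideal.quotientKerAlgEquivOfSurjective (scrollHom k s σ).rangeRestrict_surjective).trans <|
      Subalgebra.equivOfEq _ _ (range_scrollHom k s σ)

end
end

section
/- Fix an integer c > 0 and nonnegative integers σ_1 ≥ ⋯ ≥ σ_s ≥ 0 with σ_i > 0 exactly for i ≤ r. Endow N^s with the componentwise partial order (α ≤ β iff α_i ≤ β_i for all i). Then Ω_c is precisely the set of minimal elements of Λ_c under this partial order. -/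
/-!
STATEMENT 9 (Lemma `lambda0`).
Fix `c > 0` and nonnegative integers `σ₁ ≥ ⋯ ≥ σ_s ≥ 0` with `σ_i > 0` exactly for the
first `r` indices.  With `Λ_c = {α ∈ ℕ^s : α^0 = 0 and α·σ ≥ c}` and
`Ω_c = ∪_{i ≤ r} Ω_{c,i}` as in the paper, `Ω_c` is precisely the set of minimal elements
of `Λ_c` with respect to the componentwise partial order on `ℕ^s`.
(Indices are 0-based: the 1-based condition `i ≤ r` becomes `(i : ℕ) < r`.)
-/

theorem sum_add_single_mul {ι : Type*} [Fintype ι] [DecidableEq ι] (β σ : ι → ℕ) (j : ι) :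
    ∑ i, (β + Pi.single j 1 : ι → ℕ) i * σ i = ∑ i, β i * σ i + σ j := by
  simp [add_mul, Finset.sum_add_distrib, Pi.single_apply]

theorem add_single_le_of_lt {ι : Type*} [DecidableEq ι] {α β : ι → ℕ} {j : ι}
    (h : β ≤ α) (hj : β j < α j) : β + Pi.single j 1 ≤ α := by
  intro k
  by_cases hk : k = j
  · subst hk
    simpa using hj
  · simpa [hk] using h k

theorem stmt9 (s r : ℕ) (σ : Fin s → ℕ) (hσ : Antitone σ)
    (hr : ∀ i : Fin s, 0 < σ i ↔ (i : ℕ) < r)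
    (c : ℕ) (hc : 0 < c)
    (Λ Ω : Set (Fin s → ℕ))
    (hΛ : Λ = {α | (∀ i : Fin s, r ≤ (i : ℕ) → α i = 0) ∧ c ≤ ∑ i, α i * σ i})
    (hΩ : Ω = {α | ∃ i : Fin s, (i : ℕ) < r ∧ 0 < α i ∧ (∀ j : Fin s, i < j → α j = 0) ∧
      c ≤ ∑ i, α i * σ i ∧ ∑ i, α i * σ i < c + σ i}) :
    Ω = {α ∈ Λ | ∀ β ∈ Λ, β ≤ α → β = α} := by
  subst hΛ hΩ
  ext α
  constructor
  · rintro ⟨i, hir, -, hzero, hle, hlt⟩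
    refine ⟨⟨fun j hj => hzero j (Fin.lt_def.2 (hir.trans_le hj)), hle⟩, ?_⟩
    rintro β ⟨-, hβ⟩ hβα
    by_contra hne
    obtain ⟨-, j, hj⟩ := Pi.lt_def.1 (lt_of_le_of_ne hβα hne)
    have hji : j ≤ i := by
      by_contra! h
      simp [hzero j h] at hj
    have hsum : ∑ k, (β + Pi.single j 1 : Fin s → ℕ) k * σ k ≤ ∑ k, α k * σ k :=
      Finset.sum_le_sum fun k _ => Nat.mul_le_mul_right _ (add_single_le_of_lt hβα hj k)
    rw [sum_add_single_mul] at hsum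
    have := hσ hji
    omega
  · rintro ⟨⟨hzero, hle⟩, hmin⟩
    have hne : (Finset.univ.filter fun i => 0 < α i).Nonempty := by
      obtain ⟨i, -, hi⟩ := Finset.exists_ne_zero_of_sum_ne_zero (hc.trans_le hle).ne'
      exact ⟨i, by simpa using Nat.pos_of_ne_zero (left_ne_zero_of_mul hi)⟩
    obtain ⟨i, hi, hmax⟩ := Finset.exists_max_image _ id hne
    have hpos : 0 < α i := by simpa using hi
    refine ⟨i, ?_, hpos, fun j hj => ?_, hle, ?_⟩
    · by_contra! h
      exact hpos.ne' (hzero i h)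
    · by_contra h
      exact (hmax j (by simpa using Nat.pos_of_ne_zero h)).not_gt hj
    · by_contra! h
      have hsub : α - Pi.single i 1 + Pi.single i 1 = α :=
        tsub_add_cancel_of_le (by
          simpa using add_single_le_of_lt (β := 0) (zero_le (a := α)) hpos)
      have hsum := sum_add_single_mul (α - Pi.single i 1) σ i
      rw [hsub] at hsum
      have heq := hmin (α - Pi.single i 1)
        ⟨fun j hj => by simp [hzero j hj], by omega⟩ tsub_le_self
      have := congrFun heq i
      simp at this
      omega
end

section
/- Fix c > 0. The set A_c ∪ B_c is a minimal generating set for the R(M)-module R(F)_{≥−c,*} consisting of all bihomogeneous elements of R(F) of x-degree at least −c; moreover B_c alone is a minimal generating set for the R(M)_{0,*}-module R(F)_{−c,*}. -/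
/-!
STATEMENT 10 (Theorem `rfgen`).
`R = k[x₀,x₁]`, `R(F) = R[w₁,…,w_s]` bigraded with `deg xᵢ = (1,0)`, `deg wᵢ = (−σᵢ,1)`,
and `R(M) = R(F)_{≥0,*}`.  For `c > 0`, the set `A_c ∪ B_c` is a minimal generating set of
the `R(M)`-module `R(F)_{≥−c,*}`, and `B_c` is a minimal generating set of the
`R(M)_{0,*}`-module `R(F)_{−c,*}`.

Conventions: `R(F)` is realized as `MvPolynomial (Fin s) R`; an element `f` lies in
`R(F)_{≥c,*}` iff for every `w`-exponent `α` every homogeneous component of the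
coefficient `coeff α f ∈ R` of degree `< c + α·σ` vanishes (x-degree of `C r·w^α` with
`r` homogeneous of degree `e` is `e − α·σ`), and similarly for `R(F)_{c,*}` with `≠`.
Generation of a module `N` over the (sub)ring of scalars `A` by a set `G` is expressed as
`N = span {a * g | a ∈ A, g ∈ G}` over the base ring (`R`, resp. `k`).
-/

open MvPolynomial

noncomputable section

variable (k : Type) [Field k] (s r : ℕ) (σ : Fin s → ℕ) (c : ℕ)

/-- The ambient ring `R(F) = R[w₁,…,w_s]`, `R = k[x₀,x₁]`. -/
abbrev SF := MvPolynomial (Fin s) (MvPolynomial (Fin 2) k)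

/-- `α·σ`. -/
def dotσ (α : Fin s →₀ ℕ) : ℕ := ∑ i, α i * σ i

/-- membership in `R(F)_{≥ c₀, *}` : every bihomogeneous component has x-degree `≥ c₀`. -/
def xdegGE (c₀ : ℤ) (f : SF k s) : Prop :=
  ∀ (α : Fin s →₀ ℕ) (e : ℕ), (e : ℤ) < c₀ + (dotσ s σ α : ℤ) →
    homogeneousComponent e (coeff α f) = 0

/-- membership in `R(F)_{c₀, *}` : every bihomogeneous component has x-degree `= c₀`. -/
def xdegEq (c₀ : ℤ) (f : SF k s) : Prop :=
  ∀ (α : Fin s →₀ ℕ) (e : ℕ), (e : ℤ) ≠ c₀ + (dotσ s σ α : ℤ) →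
    homogeneousComponent e (coeff α f) = 0

/-- `Ω_c ⊆ ℕ^s` (0-based indices: `i < r` corresponds to `1 ≤ i ≤ r`). -/
def Omega (α : Fin s →₀ ℕ) : Prop :=
  ∃ i : Fin s, (i : ℕ) < r ∧ 0 < α i ∧ (∀ j : Fin s, i < j → α j = 0) ∧
    c ≤ dotσ s σ α ∧ dotσ s σ α < c + σ i

/-- `A_c = {w^α : α^0 = 0, α·σ < c}`. -/
def Aset : Set (SF k s) :=
  {g | ∃ α : Fin s →₀ ℕ, (∀ i : Fin s, r ≤ (i : ℕ) → α i = 0) ∧ dotσ s σ α < c ∧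
    g = monomial α 1}

/-- `B_c = {x₀^j x₁^l w^α : α ∈ Ω_c, j + l = α·σ − c}`. -/
def Bset : Set (SF k s) :=
  {g | ∃ (α : Fin s →₀ ℕ) (j l : ℕ), Omega s r σ c α ∧ j + l + c = dotσ s σ α ∧
    g = monomial α ((X 0 : MvPolynomial (Fin 2) k) ^ j * (X 1) ^ l)}

/-- the `R(M)`-multiples (as an `R`-span, `R(M) = R(F)_{≥0,*}`) of a generating set `G`. -/
def mspan (G : Set (SF k s)) : Submodule (MvPolynomial (Fin 2) k) (SF k s) :=
  Submodule.span _ {p | ∃ a, xdegGE k s σ 0 a ∧ ∃ g ∈ G, p = a * g}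

/-- the `R(M)_{0,*}`-multiples (as a `k`-span) of a generating set `G`. -/
def m0span (G : Set (SF k s)) : Submodule k (SF k s) :=
  Submodule.span _ {p | ∃ a, xdegEq k s σ 0 a ∧ ∃ g ∈ G, p = a * g}

variable {k s r σ c}

theorem dotσ_add (α β : Fin s →₀ ℕ) : dotσ s σ (α + β) = dotσ s σ α + dotσ s σ β := by
  simp [dotσ, add_mul, Finset.sum_add_distrib]

theorem dotσ_single (i : Fin s) (n : ℕ) : dotσ s σ (Finsupp.single i n) = n * σ i := by
  simp [dotσ, Finsupp.single_apply]

theorem xdegGE_iff {d : ℤ} {f : SF k s} :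
    xdegGE k s σ d f ↔ ∀ (α : Fin s →₀ ℕ) (β : Fin 2 →₀ ℕ), coeff β (coeff α f) ≠ 0 →
      d + (dotσ s σ α : ℤ) ≤ (β.degree : ℤ) := by
  constructor
  · intro h α β hne
    by_contra! hlt
    apply hne
    have := congrArg (coeff β) (h α β.degree hlt)
    simpa [coeff_homogeneousComponent] using this
  · intro h α e he
    ext β
    rw [coeff_homogeneousComponent, coeff_zero, ite_eq_right_iff]
    rintro rfl
    by_contra hne
    exact absurd (h α β hne) (not_le.mpr he)

theorem xdegEq_iff {d : ℤ} {f : SF k s} :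
    xdegEq k s σ d f ↔ ∀ (α : Fin s →₀ ℕ) (β : Fin 2 →₀ ℕ), coeff β (coeff α f) ≠ 0 →
      (β.degree : ℤ) = d + (dotσ s σ α : ℤ) := by
  constructor
  · intro h α β hne
    by_contra hlt
    apply hne
    have := congrArg (coeff β) (h α β.degree hlt)
    simpa [coeff_homogeneousComponent] using this
  · intro h α e he
    ext β
    rw [coeff_homogeneousComponent, coeff_zero, ite_eq_right_iff]
    rintro rfl
    by_contra hne
    exact he (h α β hne)

theorem xdegEq.xdegGE {d : ℤ} {f : SF k s} (h : xdegEq k s σ d f) : xdegGE k s σ d f :=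
  fun α e he => h α e he.ne

/-- A bihomogeneous monomial of a product comes from bihomogeneous monomials of the factors. -/
theorem exists_coeff_coeff_ne_zero_of_mul {f g : SF k s} {α : Fin s →₀ ℕ} {β : Fin 2 →₀ ℕ}
    (h : coeff β (coeff α (f * g)) ≠ 0) :
    ∃ α₁ α₂ β₁ β₂, α₁ + α₂ = α ∧ β₁ + β₂ = β ∧
      coeff β₁ (coeff α₁ f) ≠ 0 ∧ coeff β₂ (coeff α₂ g) ≠ 0 := by
  rw [coeff_mul, coeff_sum] at h
  obtain ⟨p, hp, h⟩ := Finset.exists_ne_zero_of_sum_ne_zero h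
  rw [coeff_mul] at h
  obtain ⟨q, hq, h⟩ := Finset.exists_ne_zero_of_sum_ne_zero h
  exact ⟨p.1, p.2, q.1, q.2, Finset.HasAntidiagonal.mem_antidiagonal.mp hp, Finset.HasAntidiagonal.mem_antidiagonal.mp hq,
    left_ne_zero_of_mul h, right_ne_zero_of_mul h⟩

theorem coeff_coeff_monomial_ne_zero {α α' : Fin s →₀ ℕ} {β β' : Fin 2 →₀ ℕ} {t : k}
    (h : coeff β (coeff α (monomial α' (monomial β' t) : SF k s)) ≠ 0) : α' = α ∧ β' = β := by
  classical
  rw [coeff_monomial] at h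
  split_ifs at h with h₁
  · rw [coeff_monomial] at h
    split_ifs at h with h₂
    · exact ⟨h₁, h₂⟩
    · exact absurd rfl h
  · exact absurd (coeff_zero _) h

theorem xdegGE_monomial {d : ℤ} {α : Fin s →₀ ℕ} {β : Fin 2 →₀ ℕ} (t : k)
    (h : d + (dotσ s σ α : ℤ) ≤ (β.degree : ℤ)) :
    xdegGE k s σ d (monomial α (monomial β t)) :=
  xdegGE_iff.mpr fun α' β' hne => by
    obtain ⟨rfl, rfl⟩ := coeff_coeff_monomial_ne_zero hne
    exact h

theorem xdegEq_monomial {d : ℤ} {α : Fin s →₀ ℕ} {β : Fin 2 →₀ ℕ} (t : k)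
    (h : (β.degree : ℤ) = d + (dotσ s σ α : ℤ)) :
    xdegEq k s σ d (monomial α (monomial β t)) :=
  xdegEq_iff.mpr fun α' β' hne => by
    obtain ⟨rfl, rfl⟩ := coeff_coeff_monomial_ne_zero hne
    exact h

theorem xdegGE.add {d : ℤ} {f g : SF k s} (hf : xdegGE k s σ d f) (hg : xdegGE k s σ d g) :
    xdegGE k s σ d (f + g) := fun α e he => by
  rw [coeff_add, map_add, hf α e he, hg α e he, add_zero]

theorem xdegEq.add {d : ℤ} {f g : SF k s} (hf : xdegEq k s σ d f) (hg : xdegEq k s σ d g) :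
    xdegEq k s σ d (f + g) := fun α e he => by
  rw [coeff_add, map_add, hf α e he, hg α e he, add_zero]

theorem xdegGE_zero (d : ℤ) : xdegGE k s σ d 0 := fun α e _ => by
  rw [coeff_zero, map_zero]

theorem xdegEq_zero (d : ℤ) : xdegEq k s σ d 0 := fun α e _ => by
  rw [coeff_zero, map_zero]

theorem xdegGE.mul {d₁ d₂ : ℤ} {f g : SF k s} (hf : xdegGE k s σ d₁ f)
    (hg : xdegGE k s σ d₂ g) : xdegGE k s σ (d₁ + d₂) (f * g) :=
  xdegGE_iff.mpr fun α β hne => by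
    obtain ⟨α₁, α₂, β₁, β₂, rfl, rfl, h₁, h₂⟩ := exists_coeff_coeff_ne_zero_of_mul hne
    have := xdegGE_iff.mp hf _ _ h₁
    have := xdegGE_iff.mp hg _ _ h₂
    rw [dotσ_add, map_add]
    push_cast
    linarith

theorem xdegEq.mul {d₁ d₂ : ℤ} {f g : SF k s} (hf : xdegEq k s σ d₁ f)
    (hg : xdegEq k s σ d₂ g) : xdegEq k s σ (d₁ + d₂) (f * g) :=
  xdegEq_iff.mpr fun α β hne => by
    obtain ⟨α₁, α₂, β₁, β₂, rfl, rfl, h₁, h₂⟩ := exists_coeff_coeff_ne_zero_of_mul hne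
    have := xdegEq_iff.mp hf _ _ h₁
    have := xdegEq_iff.mp hg _ _ h₂
    rw [dotσ_add, map_add]
    push_cast
    linarith

theorem xdegGE.smul {d : ℤ} {f : SF k s} (hf : xdegGE k s σ d f) (p : MvPolynomial (Fin 2) k) :
    xdegGE k s σ d (p • f) := by
  have hC : xdegGE k s σ 0 (C p : SF k s) := xdegGE_iff.mpr fun α β hne => by
    classical
    rw [coeff_C] at hne
    split_ifs at hne with h
    · simp [← h, dotσ]
    · exact absurd (coeff_zero _) hne
  rw [smul_eq_C_mul, ← zero_add d]
  exact hC.mul hf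

theorem xdegEq.smul {d : ℤ} {f : SF k s} (hf : xdegEq k s σ d f) (t : k) :
    xdegEq k s σ d (t • f) := fun α e he => by
  rw [coeff_smul, map_smul, hf α e he, smul_zero]

/-- Membership in an additive submonoid can be checked on bihomogeneous monomials. -/
theorem mem_of_forall_monomial_mem (N : AddSubmonoid (SF k s)) (f : SF k s)
    (h : ∀ (α : Fin s →₀ ℕ) (β : Fin 2 →₀ ℕ), coeff β (coeff α f) ≠ 0 →
      (monomial α (monomial β (coeff β (coeff α f))) : SF k s) ∈ N) : f ∈ N := by
  rw [← support_sum_monomial_coeff f]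
  refine sum_mem fun α _ => ?_
  rw [← support_sum_monomial_coeff (coeff α f), map_sum]
  exact sum_mem fun β hβ => h α β (mem_support_iff.mp hβ)

theorem mem_Aset_iff {g : SF k s} : g ∈ Aset k s r σ c ↔ ∃ α : Fin s →₀ ℕ,
    (∀ i : Fin s, r ≤ (i : ℕ) → α i = 0) ∧ dotσ s σ α < c ∧
      g = monomial α (monomial 0 1) := Iff.rfl

theorem mem_Bset_iff {g : SF k s} : g ∈ Bset k s r σ c ↔ ∃ (α : Fin s →₀ ℕ) (β : Fin 2 →₀ ℕ),
    Omega s r σ c α ∧ β.degree + c = dotσ s σ α ∧ g = monomial α (monomial β 1) := by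
  have key (j l : ℕ) : (X 0 : MvPolynomial (Fin 2) k) ^ j * X 1 ^ l =
      monomial (Finsupp.single 0 j + Finsupp.single 1 l) 1 := by
    rw [X_pow_eq_monomial, X_pow_eq_monomial, monomial_mul, one_mul]
  constructor
  · rintro ⟨α, j, l, hα, h, rfl⟩
    refine ⟨α, Finsupp.single 0 j + Finsupp.single 1 l, hα, ?_, by rw [key]⟩
    simpa using h
  · rintro ⟨α, β, hα, h, rfl⟩
    refine ⟨α, β 0, β 1, hα, ?_, ?_⟩
    · rw [← h, Finsupp.degree_eq_sum, Fin.sum_univ_two]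
    · have hβ : β = Finsupp.single 0 (β 0) + Finsupp.single 1 (β 1) := by
        ext i
        fin_cases i <;> simp
      rw [key, ← hβ]

/-- Below every exponent of weight at least `c` there is an element of `Ω_c`. -/
theorem exists_le_Omega (hr : ∀ i : Fin s, 0 < σ i ↔ (i : ℕ) < r) (hc : 0 < c)
    {α : Fin s →₀ ℕ} (hα : c ≤ dotσ s σ α) : ∃ γ ≤ α, Omega s r σ c γ := by
  obtain ⟨γ, hγα, ⟨hγ, hmin⟩⟩ :=
    exists_minimal_le_of_wellFoundedLT (fun γ : Fin s →₀ ℕ => c ≤ dotσ s σ γ) α hα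
  have hdrop (i : Fin s) (hi : 0 < γ i) : dotσ s σ γ < c + σ i := by
    have hle : Finsupp.single i 1 ≤ γ := Finsupp.single_le_iff.mpr hi
    have hadd := tsub_add_cancel_of_le hle
    have hdot := congrArg (dotσ s σ) hadd
    rw [dotσ_add, dotσ_single, one_mul] at hdot
    by_contra! hge
    have := hmin (y := γ - Finsupp.single i 1) (by dsimp only; omega) tsub_le_self i
    simp at this
    omega
  have hne : γ.support.Nonempty := by
    rw [Finsupp.support_nonempty_iff]
    rintro rfl
    simp [dotσ] at hγ
    omega
  refine ⟨γ, hγα, γ.support.max' hne, ?_, ?_, fun j hj => ?_, hγ, ?_⟩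
  · rw [← hr]
    have := hdrop _ (Nat.pos_of_ne_zero (Finsupp.mem_support_iff.mp (γ.support.max'_mem hne)))
    omega
  · exact Nat.pos_of_ne_zero (Finsupp.mem_support_iff.mp (γ.support.max'_mem hne))
  · by_contra h
    exact absurd (γ.support.le_max' j (Finsupp.mem_support_iff.mpr h)) (not_le.mpr hj)
  · exact hdrop _ (Nat.pos_of_ne_zero (Finsupp.mem_support_iff.mp (γ.support.max'_mem hne)))

/-- `Ω_c` is an antichain. -/
theorem Omega.eq_of_le (hσ : Antitone σ) {α γ : Fin s →₀ ℕ} (hα : Omega s r σ c α)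
    (hγ : Omega s r σ c γ) (hle : γ ≤ α) : γ = α := by
  obtain ⟨i, -, -, hzero, -, hlt⟩ := hα
  obtain ⟨-, -, -, -, hc, -⟩ := hγ
  by_contra hne
  obtain ⟨j, hj⟩ : ∃ j, γ j < α j := by
    by_contra! h
    exact hne (le_antisymm hle h)
  have hji : j ≤ i := by
    by_contra! h
    have := hzero j h
    omega
  have hle' : γ + Finsupp.single j 1 ≤ α := by
    intro l
    rcases eq_or_ne j l with rfl | hl
    · simpa using hj
    · simpa [hl] using hle l
  have hdot := congrArg (dotσ s σ) (add_tsub_cancel_of_le hle')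
  rw [dotσ_add, dotσ_add, dotσ_single, one_mul] at hdot
  have := hσ hji
  omega

/-- A monomial of x-degree at least `-c` and weight at least `c` is a multiple of an element of
`B_c`, the x-degree of the cofactor being larger by `c`. -/
theorem exists_mem_Bset_monomial_eq_mul (hr : ∀ i : Fin s, 0 < σ i ↔ (i : ℕ) < r) (hc : 0 < c)
    {α : Fin s →₀ ℕ} {β : Fin 2 →₀ ℕ} (t : k) (hα : c ≤ dotσ s σ α)
    (h : dotσ s σ α ≤ β.degree + c) :
    ∃ α' β', β'.degree + dotσ s σ α = β.degree + c + dotσ s σ α' ∧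
      ∃ g ∈ Bset k s r σ c,
        (monomial α (monomial β t) : SF k s) = monomial α' (monomial β' t) * g := by
  obtain ⟨γ, hγα, hγ⟩ := exists_le_Omega hr hc hα
  have hcγ : c ≤ dotσ s σ γ := by
    obtain ⟨-, -, -, -, h, -⟩ := hγ
    exact h
  have hdot := congrArg (dotσ s σ) (tsub_add_cancel_of_le hγα)
  rw [dotσ_add] at hdot
  obtain ⟨δ, hδβ, hδ⟩ := β.exists_le_degree_eq (dotσ s σ γ - c) (by omega)
  have hdeg := congrArg Finsupp.degree (tsub_add_cancel_of_le hδβ)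
  rw [map_add] at hdeg
  refine ⟨α - γ, β - δ, by omega, monomial γ (monomial δ 1),
    mem_Bset_iff.mpr ⟨γ, δ, hγ, by omega, rfl⟩, ?_⟩
  rw [monomial_mul, monomial_mul, mul_one, tsub_add_cancel_of_le hγα, tsub_add_cancel_of_le hδβ]

theorem xdegEq_of_mem_Bset {g : SF k s} (hg : g ∈ Bset k s r σ c) :
    xdegEq k s σ (-(c : ℤ)) g := by
  obtain ⟨α, β, -, h, rfl⟩ := mem_Bset_iff.mp hg
  exact xdegEq_monomial _ (by omega)

theorem xdegGE_of_mem_Aset {g : SF k s} (hg : g ∈ Aset k s r σ c) :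
    xdegGE k s σ (-(c : ℤ)) g := by
  obtain ⟨α, -, h, rfl⟩ := mem_Aset_iff.mp hg
  exact xdegGE_monomial _ (by simp; omega)

theorem xdegGE_of_mem_union {g : SF k s} (hg : g ∈ Aset k s r σ c ∪ Bset k s r σ c) :
    xdegGE k s σ (-(c : ℤ)) g :=
  hg.elim xdegGE_of_mem_Aset fun h => (xdegEq_of_mem_Bset h).xdegGE

theorem mspan_union_eq (hr : ∀ i : Fin s, 0 < σ i ↔ (i : ℕ) < r) (hc : 0 < c) :
    (mspan k s σ (Aset k s r σ c ∪ Bset k s r σ c) : Set (SF k s)) =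
      {f | xdegGE k s σ (-(c : ℤ)) f} := by
  ext f
  constructor
  · intro hf
    refine Submodule.span_induction (p := fun f _ => xdegGE k s σ (-(c : ℤ)) f) ?_
      (xdegGE_zero _) (fun _ _ _ _ => xdegGE.add) (fun p _ _ h => h.smul p) hf
    rintro _ ⟨a, ha, g, hg, rfl⟩
    simpa using ha.mul (xdegGE_of_mem_union hg)
  · intro hf
    refine mem_of_forall_monomial_mem
      (mspan k s σ (Aset k s r σ c ∪ Bset k s r σ c)).toAddSubmonoid f fun α β hne => ?_
    have hdeg := xdegGE_iff.mp hf α β hne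
    generalize coeff β (coeff α f) = t
    apply Submodule.subset_span
    rcases le_or_gt c (dotσ s σ α) with hα | hα
    · obtain ⟨α', β', h, g, hg, heq⟩ :=
        exists_mem_Bset_monomial_eq_mul (k := k) (β := β) hr hc t hα (by omega)
      exact ⟨_, xdegGE_monomial t (by omega), g, Or.inr hg, heq⟩
    · let γ := α.filter fun i : Fin s => (i : ℕ) < r
      have hγα : γ ≤ α := fun i => by
        simp only [γ, Finsupp.filter_apply]
        split_ifs <;> simp
      have hdot : dotσ s σ γ = dotσ s σ α := Finset.sum_congr rfl fun i _ => by
        simp only [γ, Finsupp.filter_apply]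
        split_ifs with h
        · rfl
        · rw [← hr, not_lt, Nat.le_zero] at h
          simp [h]
      have hsub := congrArg (dotσ s σ) (tsub_add_cancel_of_le hγα)
      rw [dotσ_add] at hsub
      refine ⟨monomial (α - γ) (monomial β t), xdegGE_monomial t (by omega),
        monomial γ (monomial 0 1), Or.inl (mem_Aset_iff.mpr ⟨γ, fun i hi => ?_, by omega, rfl⟩), ?_⟩
      · simp [γ, hi]
      · rw [monomial_mul, monomial_mul, mul_one, tsub_add_cancel_of_le hγα, add_zero]

theorem m0span_Bset_eq (hr : ∀ i : Fin s, 0 < σ i ↔ (i : ℕ) < r) (hc : 0 < c) :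
    (m0span k s σ (Bset k s r σ c) : Set (SF k s)) = {f | xdegEq k s σ (-(c : ℤ)) f} := by
  ext f
  constructor
  · intro hf
    refine Submodule.span_induction (p := fun f _ => xdegEq k s σ (-(c : ℤ)) f) ?_
      (xdegEq_zero _) (fun _ _ _ _ => xdegEq.add) (fun t _ _ h => h.smul t) hf
    rintro _ ⟨a, ha, g, hg, rfl⟩
    simpa using ha.mul (xdegEq_of_mem_Bset hg)
  · intro hf
    refine mem_of_forall_monomial_mem
      (m0span k s σ (Bset k s r σ c)).toAddSubmonoid f fun α β hne => ?_
    have hdeg := xdegEq_iff.mp hf α β hne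
    generalize coeff β (coeff α f) = t
    apply Submodule.subset_span
    obtain ⟨α', β', h, g, hg, heq⟩ :=
      exists_mem_Bset_monomial_eq_mul (k := k) (α := α) (β := β) hr hc t (by omega) (by omega)
    exact ⟨_, xdegEq_monomial t (by omega), g, hg, heq⟩

/-- An element of `A_c ∪ B_c` is a monomial, and no other element of `A_c ∪ B_c` divides it with
a cofactor in `R(M)`. -/
theorem exists_monomial_of_mem_union (hσ : Antitone σ) (hr : ∀ i : Fin s, 0 < σ i ↔ (i : ℕ) < r)
    {g₀ : SF k s} (hg₀ : g₀ ∈ Aset k s r σ c ∪ Bset k s r σ c) :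
    ∃ α₀ β₀, g₀ = monomial α₀ (monomial β₀ 1) ∧
      ∀ g ∈ Aset k s r σ c ∪ Bset k s r σ c, ∃ γ δ, g = monomial γ (monomial δ 1) ∧
        ∀ α β, α + γ = α₀ → β + δ ≤ β₀ → dotσ s σ α ≤ β.degree → g = g₀ := by
  rcases hg₀ with hg₀ | hg₀
  · obtain ⟨α₀, hzero, h₀, rfl⟩ := mem_Aset_iff.mp hg₀
    refine ⟨α₀, 0, rfl, ?_⟩
    have hα (α γ : Fin s →₀ ℕ) (β δ : Fin 2 →₀ ℕ) (hα : α + γ = α₀) (hβ : β + δ ≤ 0)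
        (hdeg : dotσ s σ α ≤ β.degree) : γ = α₀ ∧ δ = 0 := by
      obtain ⟨rfl, rfl⟩ := add_eq_zero.mp (le_antisymm hβ zero_le)
      have hdot : dotσ s σ α = 0 := by simpa using hdeg
      have : α = 0 := by
        ext i
        have hi := (Finset.sum_eq_zero_iff.mp hdot) i (Finset.mem_univ i)
        rcases Nat.mul_eq_zero.mp hi with hi | hi
        · exact hi
        · have h₁ := hzero i (not_lt.mp fun h => hi.not_gt ((hr i).mpr h))
          rw [← hα, Finsupp.add_apply] at h₁
          simp only [Finsupp.coe_zero, Pi.zero_apply]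
          omega
      rw [this, zero_add] at hα
      exact ⟨hα, rfl⟩
    rintro g (hg | hg)
    · obtain ⟨γ, -, -, rfl⟩ := mem_Aset_iff.mp hg
      refine ⟨γ, 0, rfl, fun α β h₁ h₂ h₃ => ?_⟩
      rw [(hα α γ β 0 h₁ h₂ h₃).1]
    · obtain ⟨γ, δ, -, -, rfl⟩ := mem_Bset_iff.mp hg
      refine ⟨γ, δ, rfl, fun α β h₁ h₂ h₃ => ?_⟩
      rw [(hα α γ β δ h₁ h₂ h₃).1, (hα α γ β δ h₁ h₂ h₃).2]
  · obtain ⟨α₀, β₀, hΩ, h₀, rfl⟩ := mem_Bset_iff.mp hg₀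
    refine ⟨α₀, β₀, rfl, ?_⟩
    rintro g (hg | hg)
    · obtain ⟨γ, -, hγ, rfl⟩ := mem_Aset_iff.mp hg
      refine ⟨γ, 0, rfl, fun α β h₁ h₂ h₃ => ?_⟩
      have hdot := congrArg (dotσ s σ) h₁
      rw [dotσ_add] at hdot
      have := Finsupp.degree_mono h₂
      rw [add_zero] at this
      omega
    · obtain ⟨γ, δ, hγ, hδ, rfl⟩ := mem_Bset_iff.mp hg
      refine ⟨γ, δ, rfl, fun α β h₁ h₂ h₃ => ?_⟩
      obtain rfl := hΩ.eq_of_le hσ hγ (h₁ ▸ le_add_self)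
      have hle : δ ≤ β₀ := le_add_self.trans h₂
      have hdeg := congrArg Finsupp.degree (tsub_add_cancel_of_le hle)
      rw [map_add] at hdeg
      have hsub : (β₀ - δ).degree = 0 := by omega
      rw [Finsupp.degree_eq_zero_iff, tsub_eq_zero_iff_le] at hsub
      rw [le_antisymm hle hsub]

theorem notMem_mspan_diff_singleton (hσ : Antitone σ) (hr : ∀ i : Fin s, 0 < σ i ↔ (i : ℕ) < r)
    {g₀ : SF k s} (hg₀ : g₀ ∈ Aset k s r σ c ∪ Bset k s r σ c) :
    g₀ ∉ mspan k s σ ((Aset k s r σ c ∪ Bset k s r σ c) \ {g₀}) := by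
  obtain ⟨α₀, β₀, heq, hother⟩ := exists_monomial_of_mem_union hσ hr hg₀
  intro hmem
  have hvanish : ∀ β ≤ β₀, coeff β (coeff α₀ g₀) = 0 := by
    refine Submodule.span_induction (p := fun f _ => ∀ β ≤ β₀, coeff β (coeff α₀ f) = 0)
      ?_ (by simp) ?_ ?_ hmem
    · rintro _ ⟨a, ha, g, ⟨hg, hne⟩, rfl⟩ β hβ
      by_contra h
      obtain ⟨γ, δ, hgeq, hg'⟩ := hother g hg
      obtain ⟨α₁, α₂, β₁, β₂, h₁, rfl, ha', hg''⟩ := exists_coeff_coeff_ne_zero_of_mul h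
      rw [hgeq] at hg''
      obtain ⟨rfl, rfl⟩ := coeff_coeff_monomial_ne_zero hg''
      have hdeg := xdegGE_iff.mp ha _ _ ha'
      exact hne (hg' α₁ β₁ h₁ hβ (by omega))
    · intro f g _ _ hf hg β hβ
      rw [coeff_add, coeff_add, hf β hβ, hg β hβ, add_zero]
    · intro p f _ hf β hβ
      rw [coeff_smul, smul_eq_mul, coeff_mul]
      refine Finset.sum_eq_zero fun x hx => ?_
      rw [hf x.2 ((le_add_self.trans_eq (Finset.HasAntidiagonal.mem_antidiagonal.mp hx)).trans hβ), mul_zero]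
  have := hvanish β₀ le_rfl
  rw [heq] at this
  simp at this

theorem m0span_le_mspan {G H : Set (SF k s)} (hGH : G ⊆ H) {f : SF k s}
    (hf : f ∈ m0span k s σ G) : f ∈ mspan k s σ H := by
  have hle : m0span k s σ G ≤ (mspan k s σ H).restrictScalars k := by
    refine Submodule.span_le.mpr ?_
    rintro _ ⟨a, ha, g, hg, rfl⟩
    exact Submodule.subset_span ⟨a, ha.xdegGE, g, hGH hg, rfl⟩
  exact hle hf

variable (k s r σ c)

theorem stmt10 (hσ : Antitone σ) (hr : ∀ i : Fin s, 0 < σ i ↔ (i : ℕ) < r) (hc : 0 < c) :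
    -- (c) `A_c ∪ B_c` is a minimal generating set of the `R(M)`-module `R(F)_{≥−c,*}`
    ((mspan k s σ (Aset k s r σ c ∪ Bset k s r σ c) : Set (SF k s))
        = {f | xdegGE k s σ (-(c : ℤ)) f}
      ∧ ∀ g₀ ∈ Aset k s r σ c ∪ Bset k s r σ c,
        (mspan k s σ ((Aset k s r σ c ∪ Bset k s r σ c) \ {g₀}) : Set (SF k s))
          ≠ {f | xdegGE k s σ (-(c : ℤ)) f})
    ∧
    -- (b) `B_c` is a minimal generating set of the `R(M)_{0,*}`-module `R(F)_{−c,*}`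
    ((m0span k s σ (Bset k s r σ c) : Set (SF k s)) = {f | xdegEq k s σ (-(c : ℤ)) f}
      ∧ ∀ g₀ ∈ Bset k s r σ c,
        (m0span k s σ (Bset k s r σ c \ {g₀}) : Set (SF k s))
          ≠ {f | xdegEq k s σ (-(c : ℤ)) f}) := by
  refine ⟨⟨mspan_union_eq hr hc, fun g₀ hg₀ h => ?_⟩, m0span_Bset_eq hr hc, fun g₀ hg₀ h => ?_⟩
  · refine notMem_mspan_diff_singleton hσ hr hg₀ ?_
    rw [← SetLike.mem_coe, h]
    exact xdegGE_of_mem_union hg₀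
  · have hmem : g₀ ∈ m0span k s σ (Bset k s r σ c \ {g₀}) := by
      rw [← SetLike.mem_coe, h]
      exact xdegEq_of_mem_Bset hg₀
    exact notMem_mspan_diff_singleton hσ hr (Or.inr hg₀)
      (m0span_le_mspan (Set.sdiff_subset_sdiff_left Set.subset_union_right) hmem)

end
end

section
/- Let R = k[x0,x1] and m = (x0,x1). Let ζ be an n×(n−1) matrix and η an (n−1)×n matrix, both with entries in m, such that ηζ = f·I_{n−1} for some f ∈ R. If the ideal I_{n−1}(ζ) of maximal minors of ζ has grade 2, then f ∈ I_{n−1}(ζ). -/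
/-!
STATEMENT 16 (Lemma `mxfac`).
Let `R = k[x₀,x₁]` and `𝔪 = (x₀,x₁)`.  Let `ζ` be an `(n+1) × n` matrix and `η` an
`n × (n+1)` matrix, both with entries in `𝔪`, such that `η * ζ = f • 1` for some `f ∈ R`.
If the ideal of maximal minors `I_n(ζ)` has grade 2 (i.e. it contains a regular sequence
of length two), then `f ∈ I_n(ζ)`.
-/

open MvPolynomial

namespace Matrix

variable {R : Type*} [CommRing R] {n : ℕ}

/-- The signed maximal minor of an `(n + 1) × n` matrix obtained by deleting the row `i`. -/
def signedMinor (ζ : Matrix (Fin (n + 1)) (Fin n) R) (i : Fin (n + 1)) : R :=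
  (-1) ^ (i : ℕ) * (ζ.submatrix i.succAbove id).det

/-- A vector in the left kernel of `ζ` is proportional to the vector of signed maximal minors. -/
theorem dotProduct_signedMinor_mul_of_vecMul_eq_zero (ζ : Matrix (Fin (n + 1)) (Fin n) R)
    {w : Fin (n + 1) → R} (hw : w ᵥ* ζ = 0) (u : Fin (n + 1) → R) (j : Fin (n + 1)) :
    (u ⬝ᵥ ζ.signedMinor) * w j = (w ⬝ᵥ u) * ζ.signedMinor j := by
  let M : Matrix (Fin (n + 1)) (Fin (n + 1)) R := of fun i => Fin.cons (u i) (ζ i)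
  have hadj (i : Fin (n + 1)) : M.adjugate 0 i = ζ.signedMinor i := by
    rw [adjugate_fin_succ_eq_det_submatrix, signedMinor]
    simp only [Fin.val_zero, add_zero]
    congr 2
  have hdet : M.det = u ⬝ᵥ ζ.signedMinor := by
    have h := congrFun (congrFun (adjugate_mul M) 0) 0
    simp only [mul_apply, hadj, smul_apply, one_apply_eq, smul_eq_mul, mul_one] at h
    rw [← h, dotProduct]
    exact Finset.sum_congr rfl fun i _ => by simp [M, mul_comm]
  have hwM : w ᵥ* M = Pi.single 0 (w ⬝ᵥ u) := by
    ext q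
    refine Fin.cases ?_ (fun q => ?_) q
    · simp [vecMul, dotProduct, M]
    · simpa [vecMul, dotProduct, M] using congrFun hw q
  have h : (w ᵥ* M) ᵥ* M.adjugate = M.det • w := by
    rw [vecMul_vecMul, mul_adjugate, vecMul_smul, vecMul_one]
  rw [hwM, single_vecMul] at h
  have hj := congrFun h j
  simp only [Pi.smul_apply, smul_eq_mul, row_apply, hadj] at hj
  rw [← hdet, ← hj]

theorem exists_eq_dotProduct_signedMinor (ζ : Matrix (Fin (n + 1)) (Fin n) R) {a : R}
    (ha : a ∈ Ideal.span (Set.range fun i : Fin (n + 1) =>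
      (ζ.submatrix i.succAbove id).det)) :
    ∃ u : Fin (n + 1) → R, a = u ⬝ᵥ ζ.signedMinor := by
  obtain ⟨c, rfl⟩ := Ideal.mem_span_range_iff_exists_fun.1 ha
  refine ⟨fun i => c i * (-1) ^ (i : ℕ), Finset.sum_congr rfl fun i _ => ?_⟩
  have h : ((-1 : R) ^ (i : ℕ)) * (-1) ^ (i : ℕ) = 1 := by
    rw [← mul_pow]; simp
  rw [signedMinor, mul_assoc, ← mul_assoc ((-1 : R) ^ (i : ℕ)), h, one_mul]

/-- If the ideal of maximal minors of `ζ` contains a regular sequence of length two, then the left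
kernel of `ζ` is generated by the vector of signed maximal minors. -/
theorem exists_eq_mul_signedMinor_of_vecMul_eq_zero [IsDomain R]
    (ζ : Matrix (Fin (n + 1)) (Fin n) R) {a b : R}
    (ha : a ∈ Ideal.span (Set.range fun i : Fin (n + 1) => (ζ.submatrix i.succAbove id).det))
    (hb : b ∈ Ideal.span (Set.range fun i : Fin (n + 1) => (ζ.submatrix i.succAbove id).det))
    (ha0 : a ≠ 0) (hab : ∀ c : R, c * b ∈ Ideal.span {a} → c ∈ Ideal.span {a})
    {w : Fin (n + 1) → R} (hw : w ᵥ* ζ = 0) :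
    ∃ c : R, ∀ j, w j = c * ζ.signedMinor j := by
  obtain ⟨u, rfl⟩ := ζ.exists_eq_dotProduct_signedMinor ha
  obtain ⟨v, rfl⟩ := ζ.exists_eq_dotProduct_signedMinor hb
  have hu := ζ.dotProduct_signedMinor_mul_of_vecMul_eq_zero hw u
  have hv := ζ.dotProduct_signedMinor_mul_of_vecMul_eq_zero hw v
  obtain ⟨i, hi⟩ : ∃ i, ζ.signedMinor i ≠ 0 := by
    by_contra! h
    exact ha0 (by simp [dotProduct, h])
  have hmem : w ⬝ᵥ u ∈ Ideal.span {u ⬝ᵥ ζ.signedMinor} := by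
    refine hab _ (Ideal.mem_span_singleton'.2 ⟨w ⬝ᵥ v, mul_right_cancel₀ hi ?_⟩)
    linear_combination (v ⬝ᵥ ζ.signedMinor) * hu i - (u ⬝ᵥ ζ.signedMinor) * hv i
  obtain ⟨c, hc⟩ := Ideal.mem_span_singleton'.1 hmem
  refine ⟨c, fun j => mul_left_cancel₀ ha0 ?_⟩
  rw [hu j, ← hc]
  ring

/-- If `η * ζ = f • 1` and the ideal of maximal minors of `ζ` contains a regular sequence of
length two, then `f` lies in that ideal: `f • 1 - ζ * η` is a column times the row of signed
maximal minors, and its trace is `f`. -/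
theorem mem_span_minors_of_mul_eq_smul_one [IsDomain R]
    (ζ : Matrix (Fin (n + 1)) (Fin n) R) (η : Matrix (Fin n) (Fin (n + 1)) R) {a b f : R}
    (hmul : η * ζ = f • (1 : Matrix (Fin n) (Fin n) R))
    (ha : a ∈ Ideal.span (Set.range fun i : Fin (n + 1) => (ζ.submatrix i.succAbove id).det))
    (hb : b ∈ Ideal.span (Set.range fun i : Fin (n + 1) => (ζ.submatrix i.succAbove id).det))
    (ha0 : a ≠ 0) (hab : ∀ c : R, c * b ∈ Ideal.span {a} → c ∈ Ideal.span {a}) :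
    f ∈ Ideal.span (Set.range fun i : Fin (n + 1) => (ζ.submatrix i.succAbove id).det) := by
  let P : Matrix (Fin (n + 1)) (Fin (n + 1)) R := f • 1 - ζ * η
  have hP : P * ζ = 0 := by
    simp [P, Matrix.sub_mul, Matrix.mul_assoc, hmul]
  have hrow (i : Fin (n + 1)) : ∃ c : R, ∀ j, P i j = c * ζ.signedMinor j :=
    ζ.exists_eq_mul_signedMinor_of_vecMul_eq_zero ha hb ha0 hab (congrFun hP i)
  choose c hc using hrow
  have htr : P.trace = f := by
    simp only [P, trace_sub, trace_smul, trace_one, trace_mul_comm ζ η, hmul, Fintype.card_fin,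
      smul_eq_mul]
    push_cast
    ring
  rw [← htr, trace]
  refine Ideal.sum_mem _ fun i _ => ?_
  rw [diag_apply, hc, signedMinor]
  exact Ideal.mul_mem_left _ _ (Ideal.mul_mem_left _ _ (Ideal.subset_span ⟨i, rfl⟩))

end Matrix

theorem stmt16 {k : Type} [Field k] (n : ℕ)
    (ζ : Matrix (Fin (n + 1)) (Fin n) (MvPolynomial (Fin 2) k))
    (η : Matrix (Fin n) (Fin (n + 1)) (MvPolynomial (Fin 2) k))
    (hζ : ∀ i j, ζ i j ∈ Ideal.span {(X 0 : MvPolynomial (Fin 2) k), X 1})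
    (hη : ∀ i j, η i j ∈ Ideal.span {(X 0 : MvPolynomial (Fin 2) k), X 1})
    (f : MvPolynomial (Fin 2) k)
    (hmul : η * ζ = f • (1 : Matrix (Fin n) (Fin n) (MvPolynomial (Fin 2) k)))
    -- `I_n(ζ)`, the ideal of maximal minors of `ζ`
    (J : Ideal (MvPolynomial (Fin 2) k))
    (hJ : J = Ideal.span (Set.range fun i : Fin (n + 1) =>
      (ζ.submatrix i.succAbove id).det))
    -- grade `J = 2`: `J` contains a regular sequence of length two
    (hgrade : ∃ a ∈ J, ∃ b ∈ J, a ≠ 0 ∧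
      ∀ c : MvPolynomial (Fin 2) k, c * b ∈ Ideal.span {a} → c ∈ Ideal.span {a}) :
    f ∈ J := by
  subst hJ
  obtain ⟨a, ha, b, hb, ha0, hab⟩ := hgrade
  exact ζ.mem_span_minors_of_mul_eq_smul_one η hmul ha hb ha0 hab
end
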